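/- arXiv:1709.00376 — 8 statements merged into one kernel-verified Lean document; each statement's English description precedes it below -/
import Mathlib

section
/- Let n, m be positive integers. Let f : Matrix n n ℝ × (ℝ^m) → Matrix n n ℝ be continuously differentiable, let u : ℝ × ℝ → ℝ^m be continuously differentiable, and let g : ℝ × ℝ → Matrix n n ℝ be twice continuously differentiable with g(s,t) invertible for all (s,t), satisfying the left-trivialized dynamics ∂ₜ g(s,t) = g(s,t) · f(g(s,t), u(s,t)) for all (s,t). Define the left-trivialized variation η(s,t) = g(s,t)⁻¹ · ∂ₛ g(s,t) and ν(s,t) = ∂ₛ u(s,t). Then η satisfies the linearized equation ∂ₜ η(s,t) = D₁f(g(s,t),u(s,t))[g(s,t)·η(s,t)] − (f(g(s,t),u(s,t))·η(s,t) − η(s,t)·f(g(s,t),u(s,t))) + D₂f(g(s,t),u(s,t))[ν(s,t)], where D₁f and D₂f denote the partial Fréchet derivatives of f in its first and second arguments. -/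
attribute [local instance] Matrix.normedAddCommGroup Matrix.normedSpace

/-- The mixed partial derivatives of a `C²` function on the plane exist and agree. -/
theorem ContDiff.exists_hasDerivAt_deriv_comm {E : Type*} [NormedAddCommGroup E] [NormedSpace ℝ E]
    {g : ℝ × ℝ → E} (hg : ContDiff ℝ 2 g) (s t : ℝ) :
    ∃ D : E, HasDerivAt (fun t' => deriv (fun s' => g (s', t')) s) D t ∧
      HasDerivAt (fun s' => deriv (fun t' => g (s', t')) t) D s := by
  have hs : ∀ a b : ℝ, HasDerivAt (fun x : ℝ => (x, b)) ((1, 0) : ℝ × ℝ) a := fun a b =>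
    (hasDerivAt_id a).prodMk (hasDerivAt_const a b)
  have ht : ∀ a b : ℝ, HasDerivAt (fun x : ℝ => (a, x)) ((0, 1) : ℝ × ℝ) b := fun a b =>
    (hasDerivAt_const b a).prodMk (hasDerivAt_id b)
  have hgd : Differentiable ℝ g := hg.differentiable (by norm_num)
  have hG : Differentiable ℝ (fderiv ℝ g) :=
    (hg.fderiv_right (m := 1) (by norm_num)).differentiable (by norm_num)
  have hsymm : fderiv ℝ (fderiv ℝ g) (s, t) (0, 1) (1, 0) =
      fderiv ℝ (fderiv ℝ g) (s, t) (1, 0) (0, 1) :=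
    (hg.contDiffAt.isSymmSndFDerivAt (by simp)).eq _ _
  have hg_s : ∀ a b : ℝ, deriv (fun x => g (x, b)) a = fderiv ℝ g (a, b) (1, 0) := fun a b =>
    ((hgd (a, b)).hasFDerivAt.comp_hasDerivAt a (hs a b)).deriv
  have hg_t : ∀ a b : ℝ, deriv (fun x => g (a, x)) b = fderiv ℝ g (a, b) (0, 1) := fun a b =>
    ((hgd (a, b)).hasFDerivAt.comp_hasDerivAt b (ht a b)).deriv
  simp only [hg_s, hg_t]
  refine ⟨fderiv ℝ (fderiv ℝ g) (s, t) (0, 1) (1, 0), ?_, ?_⟩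
  · have h := (hG (s, t)).hasFDerivAt.comp_hasDerivAt t (ht s t)
    simpa using h.clm_apply (hasDerivAt_const t ((1, 0) : ℝ × ℝ))
  · have h := (hG (s, t)).hasFDerivAt.comp_hasDerivAt s (hs s t)
    simpa [hsymm] using h.clm_apply (hasDerivAt_const s ((0, 1) : ℝ × ℝ))

/-- Chain rule along a pair of curves, in terms of the partial Fréchet derivatives. -/
theorem DifferentiableAt.hasDerivAt_comp_prodMk {E F H : Type*}
    [NormedAddCommGroup E] [NormedSpace ℝ E] [NormedAddCommGroup F] [NormedSpace ℝ F]
    [NormedAddCommGroup H] [NormedSpace ℝ H] {f : E × F → H} {a : ℝ → E} {b : ℝ → F}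
    {a' : E} {b' : F} {s : ℝ} (hf : DifferentiableAt ℝ f (a s, b s))
    (ha : HasDerivAt a a' s) (hb : HasDerivAt b b' s) :
    HasDerivAt (fun x => f (a x, b x))
      (fderiv ℝ (fun x => f (x, b s)) (a s) a' + fderiv ℝ (fun y => f (a s, y)) (b s) b') s := by
  have h₁ : fderiv ℝ (fun x => f (x, b s)) (a s) = _ :=
    (hf.hasFDerivAt.comp (a s) (hasFDerivAt_prodMk_left (𝕜 := ℝ) (a s) (b s))).fderiv
  have h₂ : fderiv ℝ (fun y => f (a s, y)) (b s) = _ :=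
    (hf.hasFDerivAt.comp (b s) (hasFDerivAt_prodMk_right (𝕜 := ℝ) (a s) (b s))).fderiv
  rw [h₁, h₂]
  simpa [← map_add, Function.comp_def] using hf.hasFDerivAt.comp_hasDerivAt s (ha.prodMk hb)

/-- Product rule for curves of square matrices with the entrywise norm. -/
theorem HasDerivAt.matrix_mul_entrywise {n : ℕ} {A B : ℝ → Matrix (Fin n) (Fin n) ℝ}
    {A' B' : Matrix (Fin n) (Fin n) ℝ} {t : ℝ}
    (hA : HasDerivAt A A' t) (hB : HasDerivAt B B' t) :
    HasDerivAt (fun x => A x * B x) (A' * B t + A t * B') t := by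
  refine hasDerivAt_pi.2 fun i => hasDerivAt_pi.2 fun j => ?_
  have hA' := fun k => hasDerivAt_pi.1 (hasDerivAt_pi.1 hA i) k
  have hB' := fun k => hasDerivAt_pi.1 (hasDerivAt_pi.1 hB k) j
  have h := HasDerivAt.fun_sum (u := Finset.univ) fun k _ => (hA' k).fun_mul (hB' k)
  simpa [Matrix.mul_apply, Finset.sum_add_distrib] using h

theorem DifferentiableAt.matrix_det_entrywise {n : ℕ} {A : ℝ → Matrix (Fin n) (Fin n) ℝ} {t : ℝ}
    (hA : ∀ i j, DifferentiableAt ℝ (fun x => A x i j) t) :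
    DifferentiableAt ℝ (fun x => (A x).det) t := by
  simp only [Matrix.det_apply']
  refine DifferentiableAt.fun_sum fun σ _ => DifferentiableAt.const_mul ?_ _
  exact DifferentiableAt.fun_finsetProd fun i _ => hA _ _

theorem DifferentiableAt.matrix_inv_entrywise {n : ℕ} {A : ℝ → Matrix (Fin n) (Fin n) ℝ} {t : ℝ}
    (hA : DifferentiableAt ℝ A t) (hu : IsUnit (A t)) :
    DifferentiableAt ℝ (fun x => (A x)⁻¹) t := by
  have hA' : ∀ i j, DifferentiableAt ℝ (fun x => A x i j) t := fun i j =>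
    differentiableAt_pi.1 (differentiableAt_pi.1 hA i) j
  have hdet : (A t).det ≠ 0 := ((Matrix.isUnit_iff_isUnit_det _).1 hu).ne_zero
  refine differentiableAt_pi.2 fun i => differentiableAt_pi.2 fun j => ?_
  simp only [Matrix.inv_def, Ring.inverse_eq_inv', Matrix.smul_apply, smul_eq_mul,
    Matrix.adjugate_apply]
  refine ((DifferentiableAt.matrix_det_entrywise hA').fun_inv hdet).fun_mul
    (DifferentiableAt.matrix_det_entrywise fun k l => ?_)
  simp only [Matrix.updateRow_apply]
  split_ifs
  · exact differentiableAt_const _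
  · exact hA' k l

/-- Linearization of left-trivialized dynamics on the matrix Lie group `GL(n, ℝ)`:
if `∂ₜ g = g · f(g, u)` then `η = g⁻¹ ∂ₛ g` satisfies
`∂ₜ η = D_g f · η − ad_f η + D_u f · ν` where `ν = ∂ₛ u`. -/
theorem lie_group_linearization
    (n m : ℕ) (hn : 0 < n) (hm : 0 < m)
    (f : Matrix (Fin n) (Fin n) ℝ × EuclideanSpace ℝ (Fin m) → Matrix (Fin n) (Fin n) ℝ)
    (hf : ContDiff ℝ 1 f)
    (u : ℝ × ℝ → EuclideanSpace ℝ (Fin m)) (hu : ContDiff ℝ 1 u)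
    (g : ℝ × ℝ → Matrix (Fin n) (Fin n) ℝ) (hg : ContDiff ℝ 2 g)
    (hginv : ∀ p : ℝ × ℝ, IsUnit (g p))
    (hdyn : ∀ s t : ℝ, deriv (fun t' => g (s, t')) t = g (s, t) * f (g (s, t), u (s, t)))
    (η : ℝ → ℝ → Matrix (Fin n) (Fin n) ℝ)
    (hη : ∀ s t : ℝ, η s t = (g (s, t))⁻¹ * deriv (fun s' => g (s', t)) s)
    (ν : ℝ → ℝ → EuclideanSpace ℝ (Fin m))
    (hν : ∀ s t : ℝ, ν s t = deriv (fun s' => u (s', t)) s) :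
    ∀ s t : ℝ, deriv (fun t' => η s t') t =
      fderiv ℝ (fun x => f (x, u (s, t))) (g (s, t)) (g (s, t) * η s t)
      - (f (g (s, t), u (s, t)) * η s t - η s t * f (g (s, t), u (s, t)))
      + fderiv ℝ (fun y => f (g (s, t), y)) (u (s, t)) (ν s t) := by
  intro s t
  have hgd : Differentiable ℝ g := hg.differentiable (by norm_num)
  have hg_s : HasDerivAt (fun s' => g (s', t)) (deriv (fun s' => g (s', t)) s) s :=
    DifferentiableAt.hasDerivAt ((hgd (s, t)).comp s (by fun_prop))
  have hg_t : HasDerivAt (fun t' => g (s, t')) (deriv (fun t' => g (s, t')) t) t :=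
    DifferentiableAt.hasDerivAt ((hgd (s, t)).comp t (by fun_prop))
  have hu_s : HasDerivAt (fun s' => u (s', t)) (ν s t) s := by
    rw [hν]
    exact (((hu.differentiable (by norm_num)) (s, t)).comp s (by fun_prop)).hasDerivAt
  have hgη : ∀ b : ℝ, g (s, b) * η s b = deriv (fun s' => g (s', b)) s := fun b => by
    rw [hη, Matrix.mul_nonsing_inv_cancel_left _ _ ((Matrix.isUnit_iff_isUnit_det _).1 (hginv _))]
  have hcomm : ∃ D : Matrix (Fin n) (Fin n) ℝ,
      HasDerivAt (fun t' => deriv (fun s' => g (s', t')) s) D t ∧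
      HasDerivAt (fun s' => deriv (fun t' => g (s', t')) t) D s :=
    hg.exists_hasDerivAt_deriv_comm s t
  obtain ⟨D, hst, hts⟩ := hcomm
  have hf_s : HasDerivAt (fun s' => f (g (s', t), u (s', t)))
      (fderiv ℝ (fun x => f (x, u (s, t))) (g (s, t)) (g (s, t) * η s t) +
        fderiv ℝ (fun y => f (g (s, t), y)) (u (s, t)) (ν s t)) s := by
    rw [hgη]
    exact DifferentiableAt.hasDerivAt_comp_prodMk (a := fun s' => g (s', t))
      (b := fun s' => u (s', t)) ((hf.differentiable (by norm_num)) _) hg_s hu_s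
  have hη_t : HasDerivAt (fun t' => η s t') (deriv (fun t' => η s t') t) t := by
    refine DifferentiableAt.hasDerivAt ?_
    simp only [hη]
    exact ((hg_t.differentiableAt.matrix_inv_entrywise
      (hginv _)).hasDerivAt.matrix_mul_entrywise hst).differentiableAt
  have hprod := hg_t.matrix_mul_entrywise hη_t
  simp only [hgη] at hprod
  simp only [hdyn] at hts
  have key := (hprod.unique hst).trans (hts.unique (hg_s.matrix_mul_entrywise hf_s))
  rw [hdyn, ← hgη] at key
  refine (hginv (s, t)).mul_left_cancel ?_
  rw [← sub_eq_zero] at key ⊢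
  rw [← key]
  noncomm_ring
end

section
/- Let E be a finite-dimensional real normed vector space, let τ ≤ T be real numbers, let A : ℝ → (E →L[ℝ] E) and ℓ : ℝ → (E →L[ℝ] ℝ) be continuous on [τ, T], and let φ_T : E →L[ℝ] ℝ. Suppose η : ℝ → E is differentiable on (τ, T), continuous on [τ, T], with η'(t) = A(t)(η(t)) for t ∈ (τ, T) and η(τ) = v, and suppose ρ : ℝ → (E →L[ℝ] ℝ) is differentiable on (τ, T), continuous on [τ, T], with ρ'(t) = −(ρ(t) ∘ A(t)) − ℓ(t) for t ∈ (τ, T) and ρ(T) = φ_T. Then ∫_τ^T ℓ(s)(η(s)) ds + φ_T(η(T)) = ρ(τ)(v). -/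
/-- Adjoint (costate) duality: if `η̇ = A(t) η` with `η(τ) = v` and the costate solves the
backward adjoint equation `ρ̇ = −ρ ∘ A − ℓ` with `ρ(T) = φ_T`, then
`∫_τ^T ℓ(s)(η(s)) ds + φ_T(η(T)) = ρ(τ)(v)`. -/
theorem adjoint_duality
    (E : Type*) [NormedAddCommGroup E] [NormedSpace ℝ E] [FiniteDimensional ℝ E]
    (τ T : ℝ) (hτT : τ ≤ T)
    (A : ℝ → E →L[ℝ] E) (hA : ContinuousOn A (Set.Icc τ T))
    (ℓ : ℝ → E →L[ℝ] ℝ) (hℓ : ContinuousOn ℓ (Set.Icc τ T))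
    (φT : E →L[ℝ] ℝ) (v : E)
    (η : ℝ → E) (hηc : ContinuousOn η (Set.Icc τ T))
    (hη : ∀ t ∈ Set.Ioo τ T, HasDerivAt η (A t (η t)) t)
    (hη0 : η τ = v)
    (ρ : ℝ → E →L[ℝ] ℝ) (hρc : ContinuousOn ρ (Set.Icc τ T))
    (hρ : ∀ t ∈ Set.Ioo τ T, HasDerivAt ρ (-(ρ t).comp (A t) - ℓ t) t)
    (hρT : ρ T = φT) :
    (∫ s in τ..T, ℓ s (η s)) + φT (η T) = ρ τ v := by
  have hderiv : ∀ t ∈ Set.Ioo τ T,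
      HasDerivAt (fun s => ρ s (η s)) (-(ℓ t (η t))) t := fun t ht =>
    ((hρ t ht).clm_apply (hη t ht)).congr_deriv (by simp [sub_add_eq_add_sub])
  have hint : IntervalIntegrable (fun t => -(ℓ t (η t))) MeasureTheory.volume τ T :=
    (hℓ.clm_apply hηc).neg.intervalIntegrable_of_Icc hτT
  have hFTC := intervalIntegral.integral_eq_sub_of_hasDerivAt_of_le hτT
    (hρc.clm_apply hηc) hderiv hint
  rw [intervalIntegral.integral_neg, hρT, hη0] at hFTC
  linarith
end

section
/- (Mode transition gradient on matrix Lie groups.) Let n, N be positive integers and T₀ ≤ T₁ ≤ … ≤ T_N real transition times. For k = 1,…,N let f_k : Matrix n n ℝ × ℝ → Matrix n n ℝ be continuously differentiable in its first argument and continuous in time. Let g : [T₀,T_N] → Matrix n n ℝ be continuous with invertible values and satisfy g'(t) = g(t)·f_k(g(t), t) for t ∈ (T_{k−1}, T_k). Let L, φ : Matrix n n ℝ → ℝ be continuously differentiable. Suppose ρ : [T₀,T_N] → (Matrix n n ℝ →L[ℝ] ℝ) is continuous, differentiable on each (T_{k−1},T_k), and satisfies the adjoint equation ρ'(t)(ζ)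 = −ρ(t)( D₁f_k(g(t),t)[g(t)·ζ] − (f_k(g(t),t)·ζ − ζ·f_k(g(t),t)) ) − DL(g(t))[g(t)·ζ] for all matrices ζ and t ∈ (T_{k−1},T_k), with terminal condition ρ(T_N)(ζ) = Dφ(g(T_N))[g(T_N)·ζ]. Fix i ∈ {1,…,N−1} with T_{i-1} < T_i < T_{i+1}, and suppose η : [T₀,T_N] → Matrix n n ℝ (the left-trivialized sensitivity of g with respect to T_i) satisfies: η ≡ 0 on [T₀,T_i); η is continuous on [T_i,T_N] and differentiable on each (T_{k−1},T_k) ∩ (T_i,T_N) with η'(t) = D₁f_k(g(t),t)[g(t)·η(t)] − (f_k(g(t),t)·η(t) − η(t)·f_k(g(t),t)); η(T_i) = f_i(g(T_i),T_i) − f_{i+1}(g(T_i),T_i); and the derivative of the objective J(𝒯) = ∫_{T₀}^{T_N} L(g(τ))dτ + φ(g(T_N)) with respect to T_i equals dJ/dT_i = ∫_{T_i}^{T_N} DL(g(s))[g(s)·η(s)] ds + Dφ(g(T_N))[g(T_N)·η(T_N)]. Then dJ/dT_i = ρ(T_i)( f_i(g(T_i),T_i) − f_{i+1}(g(T_i),T_i)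 ). -/
attribute [local instance] Matrix.normedAddCommGroup Matrix.normedSpace

/-- A point strictly between `T 0` and `T N` which is none of the values of `T` lies in one of the
open intervals between consecutive values. -/
theorem exists_mem_Ioo_pred_of_notMem_range {T : ℕ → ℝ} {t : ℝ} (ht : t ∉ Set.range T)
    (h0 : T 0 < t) {N : ℕ} (hN : t < T N) :
    ∃ k, 1 ≤ k ∧ k ≤ N ∧ t ∈ Set.Ioo (T (k - 1)) (T k) := by
  classical
  have hex : ∃ k, t < T k := ⟨N, hN⟩
  have hpos : 1 ≤ Nat.find hex := by
    rw [Nat.one_le_iff_ne_zero]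
    intro h
    have := Nat.find_spec hex
    rw [h] at this
    exact lt_asymm h0 this
  refine ⟨Nat.find hex, hpos, Nat.find_min' hex hN, ?_, Nat.find_spec hex⟩
  have hle : T (Nat.find hex - 1) ≤ t :=
    not_lt.mp (Nat.find_min hex (Nat.sub_lt hpos one_pos))
  exact lt_of_le_of_ne hle fun h => ht ⟨_, h⟩

/-- Mode transition gradient on matrix Lie groups: for a switched system
`ġ = g · f_k(g, t)` on `(T_{k-1}, T_k)` with adjoint costate `ρ` and left-trivialized
sensitivity `η` of `g` with respect to the transition time `T_i`, the derivative of
`J(𝒯) = ∫ L(g) + φ(g(T_N))` with respect to `T_i` equals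
`ρ(T_i)(f_i(g(T_i), T_i) − f_{i+1}(g(T_i), T_i))`. -/
theorem mode_transition_gradient
    (n N : ℕ) (hn : 0 < n) (hN : 0 < N)
    (T : ℕ → ℝ) (hT : ∀ k < N, T k ≤ T (k + 1))
    (f : ℕ → Matrix (Fin n) (Fin n) ℝ → ℝ → Matrix (Fin n) (Fin n) ℝ)
    (hf : ∀ k, 1 ≤ k → k ≤ N → ∀ t : ℝ, ContDiff ℝ 1 (fun x => f k x t))
    (hft : ∀ k, 1 ≤ k → k ≤ N →
      Continuous (fun p : Matrix (Fin n) (Fin n) ℝ × ℝ => f k p.1 p.2))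
    (g : ℝ → Matrix (Fin n) (Fin n) ℝ)
    (hgc : ContinuousOn g (Set.Icc (T 0) (T N)))
    (hginv : ∀ t ∈ Set.Icc (T 0) (T N), IsUnit (g t))
    (hgdyn : ∀ k, 1 ≤ k → k ≤ N → ∀ t ∈ Set.Ioo (T (k - 1)) (T k),
      HasDerivAt g (g t * f k (g t) t) t)
    (L φ : Matrix (Fin n) (Fin n) ℝ → ℝ) (hL : ContDiff ℝ 1 L) (hφ : ContDiff ℝ 1 φ)
    (ρ ρd : ℝ → Matrix (Fin n) (Fin n) ℝ →L[ℝ] ℝ)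
    (hρc : ContinuousOn ρ (Set.Icc (T 0) (T N)))
    (hρ : ∀ k, 1 ≤ k → k ≤ N → ∀ t ∈ Set.Ioo (T (k - 1)) (T k), HasDerivAt ρ (ρd t) t)
    (hρd : ∀ k, 1 ≤ k → k ≤ N → ∀ t ∈ Set.Ioo (T (k - 1)) (T k),
      ∀ ζ : Matrix (Fin n) (Fin n) ℝ,
        ρd t ζ = -(ρ t (fderiv ℝ (fun x => f k x t) (g t) (g t * ζ)
            - (f k (g t) t * ζ - ζ * f k (g t) t)))
          - fderiv ℝ L (g t) (g t * ζ))
    (hρT : ∀ ζ : Matrix (Fin n) (Fin n) ℝ,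
      ρ (T N) ζ = fderiv ℝ φ (g (T N)) (g (T N) * ζ))
    (i : ℕ) (hi1 : 1 ≤ i) (hi2 : i ≤ N - 1)
    (hTi : T (i - 1) < T i) (hTi' : T i < T (i + 1))
    (η : ℝ → Matrix (Fin n) (Fin n) ℝ)
    (hη0 : ∀ t ∈ Set.Ico (T 0) (T i), η t = 0)
    (hηc : ContinuousOn η (Set.Icc (T i) (T N)))
    (hηd : ∀ k, 1 ≤ k → k ≤ N →
      ∀ t ∈ Set.Ioo (T (k - 1)) (T k) ∩ Set.Ioo (T i) (T N),
        HasDerivAt η (fderiv ℝ (fun x => f k x t) (g t) (g t * η t)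
          - (f k (g t) t * η t - η t * f k (g t) t)) t)
    (hηi : η (T i) = f i (g (T i)) (T i) - f (i + 1) (g (T i)) (T i))
    (dJ : ℝ)
    (hdJ : dJ = (∫ s in (T i)..(T N), fderiv ℝ L (g s) (g s * η s))
      + fderiv ℝ φ (g (T N)) (g (T N) * η (T N))) :
    dJ = ρ (T i) (f i (g (T i)) (T i) - f (i + 1) (g (T i)) (T i)) := by
  have hmono : ∀ a b, a ≤ b → b ≤ N → T a ≤ T b := by
    intro a b hab
    induction b, hab using Nat.le_induction with
    | base => exact fun _ => le_rfl
    | succ b _ ih => exact fun hb => (ih (by omega)).trans (hT b (by omega))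
  have h0i : T 0 ≤ T i := hmono 0 i (by omega) (by omega)
  have hiN : T i ≤ T N := hmono i N (by omega) le_rfl
  have hsub : Set.Icc (T i) (T N) ⊆ Set.Icc (T 0) (T N) := Set.Icc_subset_Icc_left h0i
  have hpair : ContinuousOn (fun t => ρ t (η t)) (Set.Icc (T i) (T N)) :=
    (hρc.mono hsub).clm_apply hηc
  have hg' := hgc.mono hsub
  have hrun : ContinuousOn (fun t => fderiv ℝ L (g t) (g t * η t)) (Set.Icc (T i) (T N)) :=
    ((hL.continuous_fderiv one_ne_zero).comp_continuousOn hg').clm_apply (hg'.mul hηc)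
  have hderiv : ∀ t ∈ Set.Ioo (T i) (T N) \ Set.range T,
      HasDerivAt (fun t => ρ t (η t)) (-fderiv ℝ L (g t) (g t * η t)) t := by
    rintro t ⟨ht, htT⟩
    obtain ⟨k, hk1, hkN, hk⟩ :=
      exists_mem_Ioo_pred_of_notMem_range htT (h0i.trans_lt ht.1) ht.2
    have h := (hρ k hk1 hkN t hk).clm_apply (hηd k hk1 hkN t ⟨hk, ht⟩)
    refine h.congr_deriv ((congrArg (· + _) (hρd k hk1 hkN t hk (η t))).trans ?_)
    exact (congrArg (· + _) (neg_sub_comm _ _)).trans (sub_add_cancel _ _)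
  have hint := MeasureTheory.integral_eq_of_hasDerivAt_off_countable_of_le
    (fun t => ρ t (η t)) _ hiN (Set.countable_range T) hpair hderiv
    (hrun.neg.intervalIntegrable_of_Icc hiN)
  rw [intervalIntegral.integral_neg] at hint
  rw [hdJ, ← hρT, ← hηi]
  linarith
end

section
/- (Mode insertion gradient on matrix Lie groups.) Let n be a positive integer, T₀ ≤ τ₀ < T_N real numbers, and f₁, f₂ : Matrix n n ℝ × ℝ → Matrix n n ℝ continuously differentiable in the first argument and continuous in time. Let g : [T₀,T_N] → Matrix n n ℝ be continuous with invertible values and satisfy the nominal dynamics g'(t) = g(t)·f₁(g(t), t) on (T₀,T_N). Let L, φ : Matrix n n ℝ → ℝ be continuously differentiable. Suppose ρ : [T₀,T_N] → (Matrix n n ℝ →L[ℝ] ℝ) is continuous, differentiable on (T₀,T_N), and satisfies ρ'(t)(ζ) = −ρ(t)( D₁f₁(g(t),t)[g(t)·ζ] − (f₁(g(t),t)·ζ − ζ·f₁(g(t),t)) ) − DL(g(t))[g(t)·ζ] for all matrices ζ, with terminal condition ρ(T_N)(ζ) = Dφ(g(T_N))[g(T_N)·ζ]. Suppose η : [T₀,T_N]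 → Matrix n n ℝ (the left-trivialized sensitivity of g with respect to the insertion duration λ at λ = 0⁺) satisfies: η ≡ 0 on [T₀,τ₀); η is continuous on [τ₀,T_N] and differentiable on (τ₀,T_N) with η'(t) = D₁f₁(g(t),t)[g(t)·η(t)] − (f₁(g(t),t)·η(t) − η(t)·f₁(g(t),t)); η(τ₀) = f₂(g(τ₀),τ₀) − f₁(g(τ₀),τ₀); and the right derivative at λ = 0⁺ of the objective J(λ) = ∫_{T₀}^{T_N} L(g_λ(τ))dτ + φ(g_λ(T_N)) along the trajectories g_λ obtained by switching to mode f₂ on [τ₀, τ₀+λ) equals (dJ/dλ)|_{0⁺} = ∫_{τ₀}^{T_N} DL(g(s))[g(s)·η(s)] ds + Dφ(g(T_N))[g(T_N)·η(T_N)]. Then (dJ/dλ)|_{0⁺} = ρ(τ₀)( f₂(g(τ₀),τ₀) − f₁(g(τ₀),τ₀) ). -/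
attribute [local instance] Matrix.normedAddCommGroup Matrix.normedSpace

/-- Mode insertion gradient on matrix Lie groups: for the nominal dynamics
`ġ = g · f₁(g, t)` with adjoint costate `ρ` and left-trivialized sensitivity `η`
of `g` with respect to the insertion duration `λ` at `λ = 0⁺`, the right derivative
at `λ = 0⁺` of `J(λ)` equals `ρ(τ₀)(f₂(g(τ₀), τ₀) − f₁(g(τ₀), τ₀))`. -/
theorem mode_insertion_gradient
    (n : ℕ) (hn : 0 < n)
    (T₀ τ₀ TN : ℝ) (hT₀ : T₀ ≤ τ₀) (hτ₀ : τ₀ < TN)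
    (f₁ f₂ : Matrix (Fin n) (Fin n) ℝ → ℝ → Matrix (Fin n) (Fin n) ℝ)
    (hf₁ : ∀ t : ℝ, ContDiff ℝ 1 (fun x => f₁ x t))
    (hf₂ : ∀ t : ℝ, ContDiff ℝ 1 (fun x => f₂ x t))
    (hf₁t : Continuous (fun p : Matrix (Fin n) (Fin n) ℝ × ℝ => f₁ p.1 p.2))
    (hf₂t : Continuous (fun p : Matrix (Fin n) (Fin n) ℝ × ℝ => f₂ p.1 p.2))
    (g : ℝ → Matrix (Fin n) (Fin n) ℝ)
    (hgc : ContinuousOn g (Set.Icc T₀ TN))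
    (hginv : ∀ t ∈ Set.Icc T₀ TN, IsUnit (g t))
    (hgdyn : ∀ t ∈ Set.Ioo T₀ TN, HasDerivAt g (g t * f₁ (g t) t) t)
    (L φ : Matrix (Fin n) (Fin n) ℝ → ℝ) (hL : ContDiff ℝ 1 L) (hφ : ContDiff ℝ 1 φ)
    (ρ ρd : ℝ → Matrix (Fin n) (Fin n) ℝ →L[ℝ] ℝ)
    (hρc : ContinuousOn ρ (Set.Icc T₀ TN))
    (hρ : ∀ t ∈ Set.Ioo T₀ TN, HasDerivAt ρ (ρd t) t)
    (hρd : ∀ t ∈ Set.Ioo T₀ TN, ∀ ζ : Matrix (Fin n) (Fin n) ℝ,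
      ρd t ζ = -(ρ t (fderiv ℝ (fun x => f₁ x t) (g t) (g t * ζ)
          - (f₁ (g t) t * ζ - ζ * f₁ (g t) t)))
        - fderiv ℝ L (g t) (g t * ζ))
    (hρT : ∀ ζ : Matrix (Fin n) (Fin n) ℝ,
      ρ TN ζ = fderiv ℝ φ (g TN) (g TN * ζ))
    (η : ℝ → Matrix (Fin n) (Fin n) ℝ)
    (hη0 : ∀ t ∈ Set.Ico T₀ τ₀, η t = 0)
    (hηc : ContinuousOn η (Set.Icc τ₀ TN))
    (hηd : ∀ t ∈ Set.Ioo τ₀ TN,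
      HasDerivAt η (fderiv ℝ (fun x => f₁ x t) (g t) (g t * η t)
        - (f₁ (g t) t * η t - η t * f₁ (g t) t)) t)
    (hητ : η τ₀ = f₂ (g τ₀) τ₀ - f₁ (g τ₀) τ₀)
    (dJ : ℝ)
    (hdJ : dJ = (∫ s in τ₀..TN, fderiv ℝ L (g s) (g s * η s))
      + fderiv ℝ φ (g TN) (g TN * η TN)) :
    dJ = ρ τ₀ (f₂ (g τ₀) τ₀ - f₁ (g τ₀) τ₀) := by
  have hsub : Set.Icc τ₀ TN ⊆ Set.Icc T₀ TN := Set.Icc_subset_Icc_left hT₀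
  have hpair : ContinuousOn (fun t => ρ t (η t)) (Set.Icc τ₀ TN) :=
    (hρc.mono hsub).clm_apply hηc
  have hderiv : ∀ t ∈ Set.Ioo τ₀ TN,
      HasDerivAt (fun t => ρ t (η t)) (-(fderiv ℝ L (g t) (g t * η t))) t := by
    intro t ht
    have ht' : t ∈ Set.Ioo T₀ TN := Set.Ioo_subset_Ioo_left hT₀ ht
    have h := (hρ t ht').clm_apply (hηd t ht)
    have key : ∀ a b : ℝ, -a - b + a = -b := fun a b => by ring
    exact h.congr_deriv ((congrArg (· + _) (hρd t ht' (η t))).trans (key _ _))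
  have hcont : ContinuousOn (fun t => fderiv ℝ L (g t) (g t * η t)) (Set.Icc τ₀ TN) :=
    ((hL.continuous_fderiv one_ne_zero).comp_continuousOn (hgc.mono hsub)).clm_apply
      ((hgc.mono hsub).mul hηc)
  have hint : IntervalIntegrable (fun t => -(fderiv ℝ L (g t) (g t * η t)))
      MeasureTheory.volume τ₀ TN :=
    hcont.neg.intervalIntegrable_of_Icc hτ₀.le
  have hftc := intervalIntegral.integral_eq_sub_of_hasDerivAt_of_le hτ₀.le hpair hderiv hint
  rw [intervalIntegral.integral_neg] at hftc
  rw [hdJ, ← hρT, ← hητ]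
  linarith
end

section
/- Let n, m be positive integers, ρ ∈ ℝⁿ, h an n×m real matrix, u₁ ∈ ℝ^m, α_d ∈ ℝ, and R an m×m real symmetric positive definite matrix. Let Λ = hᵀρρᵀh (an m×m positive semidefinite matrix of rank at most one). Then Λ + R is invertible, and the vector u₂* = u₁ + (Λ + R)⁻¹ hᵀρ α_d is the unique global minimizer over u ∈ ℝ^m of the function F(u) = (ρᵀh(u − u₁) − α_d)² + (u − u₁)ᵀ R (u − u₁); that is, F(u₂*) ≤ F(u) for all u ∈ ℝ^m, with equality only when u = u₂*. -/
open Matrix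

/-- Completing the square for a quadratic function whose linear part is `A *ᵥ p`. -/
theorem Matrix.IsSymm.dotProduct_mulVec_sub_two_mul {ι S : Type*} [Fintype ι] [CommRing S]
    {A : Matrix ι ι S} (hA : A.IsSymm) (p d : ι → S) :
    d ⬝ᵥ A *ᵥ d - 2 * (A *ᵥ p ⬝ᵥ d) =
      (d - p) ⬝ᵥ A *ᵥ (d - p) - p ⬝ᵥ A *ᵥ p := by
  have hpd : p ⬝ᵥ A *ᵥ d = A *ᵥ p ⬝ᵥ d := by
    rw [dotProduct_mulVec, ← mulVec_transpose, hA.eq]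
  simp only [mulVec_sub, sub_dotProduct, dotProduct_sub, hpd, dotProduct_comm d (A *ᵥ p)]
  ring

/-- The quadratic form of `v vᵀ` is the square of the linear form of `v`. -/
theorem Matrix.dotProduct_vecMulVec_self_mulVec {ι S : Type*} [Fintype ι] [CommRing S]
    (v d : ι → S) : d ⬝ᵥ vecMulVec v v *ᵥ d = (v ⬝ᵥ d) ^ 2 := by
  rw [vecMulVec_mulVec, op_smul_eq_smul, dotProduct_smul, dotProduct_comm d v, smul_eq_mul, sq]

/-- Closed-form solution of the SAC adjoint optimization: with `Λ = hᵀρρᵀh` and `R`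
symmetric positive definite, `Λ + R` is invertible and
`u₂* = u₁ + (Λ + R)⁻¹ hᵀ ρ α_d` is the unique global minimizer of
`F(u) = (ρᵀh(u − u₁) − α_d)² + (u − u₁)ᵀ R (u − u₁)`. -/
theorem sac_closed_form_optimal_action
    (n m : ℕ) (hn : 0 < n) (hm : 0 < m)
    (ρ : Fin n → ℝ) (h : Matrix (Fin n) (Fin m) ℝ)
    (u₁ : Fin m → ℝ) (αd : ℝ)
    (R : Matrix (Fin m) (Fin m) ℝ) (hR : R.PosDef)
    (Λ : Matrix (Fin m) (Fin m) ℝ) (hΛ : Λ = hᵀ * Matrix.vecMulVec ρ ρ * h)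
    (F : (Fin m → ℝ) → ℝ)
    (hF : ∀ u : Fin m → ℝ,
      F u = (ρ ⬝ᵥ h.mulVec (u - u₁) - αd) ^ 2 + (u - u₁) ⬝ᵥ R.mulVec (u - u₁))
    (u₂ : Fin m → ℝ)
    (hu₂ : u₂ = u₁ + αd • (Λ + R)⁻¹.mulVec (hᵀ.mulVec ρ)) :
    IsUnit (Λ + R) ∧ (∀ u : Fin m → ℝ, F u₂ ≤ F u) ∧
      (∀ u : Fin m → ℝ, F u = F u₂ → u = u₂) := by
  set g : Fin m → ℝ := hᵀ *ᵥ ρ with hg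
  have hΛg : Λ = vecMulVec g g := by
    rw [hΛ, mul_vecMulVec, vecMulVec_mul, ← mulVec_transpose]
  have hA : (Λ + R).PosDef := by
    rw [hΛg]
    simpa using hR.posSemidef_add (posSemidef_vecMulVec_self_star g)
  have hsymm : (Λ + R).IsSymm := by
    simpa [IsSymm, IsHermitian] using hA.isHermitian
  have hp : (Λ + R) *ᵥ (u₂ - u₁) = αd • g := by
    rw [hu₂, add_sub_cancel_left, mulVec_smul, mulVec_mulVec,
      mul_nonsing_inv _ ((isUnit_iff_isUnit_det _).1 hA.isUnit), one_mulVec]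
  have hexp (u : Fin m → ℝ) : F u = (u - u₂) ⬝ᵥ (Λ + R) *ᵥ (u - u₂)
      - (u₂ - u₁) ⬝ᵥ (Λ + R) *ᵥ (u₂ - u₁) + αd ^ 2 := by
    have hsq := hsymm.dotProduct_mulVec_sub_two_mul (u₂ - u₁) (u - u₁)
    have hquad : (u - u₁) ⬝ᵥ (Λ + R) *ᵥ (u - u₁)
        = (g ⬝ᵥ (u - u₁)) ^ 2 + (u - u₁) ⬝ᵥ R *ᵥ (u - u₁) := by
      rw [add_mulVec, dotProduct_add, hΛg, dotProduct_vecMulVec_self_mulVec]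
    have hlin : (Λ + R) *ᵥ (u₂ - u₁) ⬝ᵥ (u - u₁) = αd * (g ⬝ᵥ (u - u₁)) := by
      rw [hp, smul_dotProduct, smul_eq_mul]
    rw [sub_sub_sub_cancel_right, hquad, hlin] at hsq
    rw [hF, dotProduct_mulVec, ← mulVec_transpose, ← hg]
    linear_combination hsq
  have hdiff (u : Fin m → ℝ) : F u = F u₂ + (u - u₂) ⬝ᵥ (Λ + R) *ᵥ (u - u₂) := by
    rw [hexp u, hexp u₂, sub_self, zero_dotProduct]
    ring
  refine ⟨hA.isUnit, fun u => ?_, fun u hu => ?_⟩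
  · have hnonneg := hA.posSemidef.dotProduct_mulVec_nonneg (u - u₂)
    rw [star_trivial] at hnonneg
    linarith [hdiff u]
  · by_contra hne
    have hpos := hA.dotProduct_mulVec_pos (sub_ne_zero.2 hne)
    rw [star_trivial] at hpos
    linarith [hdiff u]
end

section
/- Let m be a positive integer, b ∈ ℝ^m, u₁, u_min, u_max ∈ ℝ^m with u_min,i < u₁,i < u_max,i for every i, α_d < 0 a real number, and R an m×m diagonal matrix with strictly positive diagonal entries. Let d* = (bbᵀ + R)⁻¹ b α_d, and define the saturated control u₂ˢ ∈ ℝ^m componentwise by u₂ˢᵢ = max(u_min,i, min(u_max,i, u₁,i + d*ᵢ)). Then bᵀ(u₂ˢ − u₁) ≤ 0, and if b ≠ 0 then bᵀ(u₂ˢ − u₁) < 0. -/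
open Matrix

/-- The unsaturated step in closed form (Sherman–Morrison applied to `b`). -/
theorem inv_vecMulVec_add_diagonal_mulVec {ι : Type*} [Fintype ι] [DecidableEq ι]
    (b r : ι → ℝ) (hr : ∀ i, 0 < r i) :
    (vecMulVec b b + diagonal r)⁻¹ *ᵥ b = fun i => b i / (r i * (1 + ∑ j, b j ^ 2 / r j)) := by
  set q := ∑ j, b j ^ 2 / r j with hq
  have hq0 : 0 ≤ q := Finset.sum_nonneg fun j _ => div_nonneg (sq_nonneg _) (hr j).le
  set M := vecMulVec b b + diagonal r
  have hM : M.PosDef :=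
    PosDef.posSemidef_add (by simpa using posSemidef_vecMulVec_self_star b)
      (PosDef.diagonal hr)
  have hdet : IsUnit M.det := (isUnit_iff_isUnit_det M).mp hM.isUnit
  set w : ι → ℝ := fun i => b i / (r i * (1 + q)) with hw
  have hbw : b ⬝ᵥ w = q / (1 + q) := by
    rw [hq, Finset.sum_div, ← hq]
    refine Finset.sum_congr rfl fun i _ => ?_
    have := (hr i).ne'
    simp only [hw]
    field_simp
  have hMw : M *ᵥ w = b := by
    ext i
    have := (hr i).ne'
    have : 1 + q ≠ 0 := by positivity
    simp only [M, add_mulVec, vecMulVec_mulVec, mulVec_diagonal, Pi.add_apply, Pi.smul_apply,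
      MulOpposite.smul_eq_mul_unop, MulOpposite.unop_op, hbw]
    simp only [hw]
    field_simp
    ring
  calc M⁻¹ *ᵥ b = M⁻¹ *ᵥ (M *ᵥ w) := by rw [hMw]
    _ = w := by rw [mulVec_mulVec, nonsing_inv_mul M hdet, one_mulVec]

/-- Clamping to an interval around `u` keeps the strict sign of a step away from `u`. -/
theorem mul_clamp_sub_neg {β u lo hi c : ℝ} (hlo : lo < u) (hhi : u < hi) (hc : c < 0)
    (hβ : β ≠ 0) : β * (max lo (min hi (u + c * β)) - u) < 0 := by
  rcases hβ.lt_or_gt with h | h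
  · have : 0 < c * β := mul_pos_of_neg_of_neg hc h
    exact mul_neg_of_neg_of_pos h
      (sub_pos.mpr (lt_max_of_lt_right (lt_min hhi (by linarith))))
  · have : c * β < 0 := mul_neg_of_neg_of_pos hc h
    exact mul_neg_of_pos_of_neg h
      (sub_neg.mpr (max_lt hlo (min_lt_of_right_lt (by linarith))))

/-- Elementwise saturation of the SAC control action preserves a nonpositive
(negative, when `b ≠ 0`) mode insertion gradient, provided `u_min < u₁ < u_max`
componentwise, `α_d < 0` and `R` is diagonal with positive diagonal entries. -/
theorem sac_saturation_preserves_descent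
    (m : ℕ) (hm : 0 < m)
    (b u₁ umin umax : Fin m → ℝ)
    (hbounds : ∀ i, umin i < u₁ i ∧ u₁ i < umax i)
    (αd : ℝ) (hαd : αd < 0)
    (r : Fin m → ℝ) (hr : ∀ i, 0 < r i)
    (d : Fin m → ℝ)
    (hd : d = αd • (Matrix.vecMulVec b b + Matrix.diagonal r)⁻¹.mulVec b)
    (u₂ : Fin m → ℝ)
    (hu₂ : ∀ i, u₂ i = max (umin i) (min (umax i) (u₁ i + d i))) :
    b ⬝ᵥ (u₂ - u₁) ≤ 0 ∧ (b ≠ 0 → b ⬝ᵥ (u₂ - u₁) < 0) := by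
  have hq0 : 0 ≤ ∑ j, b j ^ 2 / r j :=
    Finset.sum_nonneg fun j _ => div_nonneg (sq_nonneg _) (hr j).le
  have hneg : ∀ i, b i ≠ 0 → b i * (u₂ - u₁) i < 0 := by
    intro i hi
    have hc : αd / (r i * (1 + ∑ j, b j ^ 2 / r j)) < 0 :=
      div_neg_of_neg_of_pos hαd (mul_pos (hr i) (by linarith))
    have hdi : d i = αd / (r i * (1 + ∑ j, b j ^ 2 / r j)) * b i := by
      rw [hd, inv_vecMulVec_add_diagonal_mulVec b r hr, Pi.smul_apply, smul_eq_mul]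
      ring
    rw [Pi.sub_apply, hu₂, hdi]
    exact mul_clamp_sub_neg (hbounds i).1 (hbounds i).2 hc hi
  have hnonpos : ∀ i, b i * (u₂ - u₁) i ≤ 0 := by
    intro i
    by_cases hi : b i = 0
    · simp [hi]
    · exact (hneg i hi).le
  refine ⟨Finset.sum_nonpos fun i _ => hnonpos i, fun hb => ?_⟩
  obtain ⟨i, hi⟩ := Function.ne_iff.mp hb
  exact Finset.sum_neg' (fun j _ => hnonpos j) ⟨i, Finset.mem_univ i, hneg i hi⟩
end

section
/- Let ω ∈ ℝ³ with ω ≠ 0, write θ = ‖ω‖ and K = ω̂. Then the series ∑_{j=0}^∞ (1/(j+1)!) K^j converges and equals I + ((1 − cos θ)/θ²) K + ((θ − sin θ)/θ³) K², where I is the 3×3 identity matrix. -/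
open Real

/-- The hat map `∧ : ℝ³ → 𝔰𝔬(3)`. -/
noncomputable def hatSO3 (ω : EuclideanSpace ℝ (Fin 3)) : Matrix (Fin 3) (Fin 3) ℝ :=
  !![0, -ω 2, ω 1; ω 2, 0, -ω 0; -ω 1, ω 0, 0]

open scoped Nat in
theorem hasSum_one_sub_cos_div_sq {x : ℝ} (hx : x ≠ 0) :
    HasSum (fun n : ℕ => (((2 * n + 1 + 1)! : ℝ))⁻¹ * (-x ^ 2) ^ n) ((1 - cos x) / x ^ 2) := by
  have h := ((hasSum_nat_add_iff' 1).mpr (Real.hasSum_cos x)).mul_left (-(x ^ 2)⁻¹)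
  convert h using 1
  · rfl
  · funext n
    rw [neg_pow, show 2 * (n + 1) = 2 * n + 1 + 1 by ring]
    field_simp
    ring
  · simp
    field_simp
    ring

open scoped Nat in
theorem hasSum_sub_sin_div_cube {x : ℝ} (hx : x ≠ 0) :
    HasSum (fun n : ℕ => (((2 * (n + 1) + 1)! : ℝ))⁻¹ * (-x ^ 2) ^ n)
      ((x - sin x) / x ^ 3) := by
  have h := ((hasSum_nat_add_iff' 1).mpr (Real.hasSum_sin x)).mul_left (-(x ^ 3)⁻¹)
  convert h using 1
  · rfl
  · funext n
    rw [neg_pow]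
    field_simp
    ring
  · simp
    field_simp
    ring

theorem hatSO3_pow_three (ω : EuclideanSpace ℝ (Fin 3)) :
    hatSO3 ω ^ 3 = (-‖ω‖ ^ 2) • hatSO3 ω := by
  rw [EuclideanSpace.real_norm_sq_eq, Fin.sum_univ_three]
  ext i j
  fin_cases i <;> fin_cases j <;>
    simp [hatSO3, pow_succ, Matrix.mul_apply, Fin.sum_univ_three] <;> ring

theorem hatSO3_pow_two_mul_add_one (ω : EuclideanSpace ℝ (Fin 3)) (n : ℕ) :
    hatSO3 ω ^ (2 * n + 1) = (-‖ω‖ ^ 2) ^ n • hatSO3 ω := by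
  induction n with
  | zero => simp
  | succ n ih =>
    rw [show 2 * (n + 1) + 1 = (2 * n + 1) + 2 by ring, pow_add, ih, smul_mul_assoc,
      ← pow_succ', hatSO3_pow_three, smul_smul, ← pow_succ]

/-- Exact closed form of `dexp` on `SO(3)`: for `ω ≠ 0`, `θ = ‖ω‖`, `K = ω̂`,
`∑_{j≥0} K^j/(j+1)! = I + ((1 − cos θ)/θ²) K + ((θ − sin θ)/θ³) K²`. -/
theorem dexp_so3_closed_form (ω : EuclideanSpace ℝ (Fin 3)) (hω : ω ≠ 0) :
    HasSum (fun j : ℕ => (((j + 1).factorial : ℝ))⁻¹ • hatSO3 ω ^ j)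
      (1 + ((1 - cos ‖ω‖) / ‖ω‖ ^ 2) • hatSO3 ω
        + ((‖ω‖ - sin ‖ω‖) / ‖ω‖ ^ 3) • hatSO3 ω ^ 2) := by
  have hθ : ‖ω‖ ≠ 0 := norm_ne_zero_iff.mpr hω
  rw [add_right_comm]
  refine HasSum.even_add_odd ?_ ?_
  · rw [← hasSum_nat_add_iff' 1]
    convert (hasSum_sub_sin_div_cube hθ).smul_const (hatSO3 ω ^ 2) using 1
    · rfl
    · funext n
      rw [mul_smul, show 2 * (n + 1) = (2 * n + 1) + 1 by ring, pow_succ (hatSO3 ω) (2 * n + 1),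
        hatSO3_pow_two_mul_add_one, smul_mul_assoc, sq (hatSO3 ω)]
    · simp
  · convert (hasSum_one_sub_cos_div_sq hθ).smul_const (hatSO3 ω) using 1
    funext n
    rw [mul_smul, hatSO3_pow_two_mul_add_one]
end

section
/- Let ω, u, v ∈ ℝ with cos ω ≠ 1, and let P be the 3×3 real matrix with rows (1, 0, 0), (a₁, sin ω/ω, −(1 − cos ω)/ω), (a₂, (1 − cos ω)/ω, sin ω/ω), where a₁ = (u(ω − sin ω) + v(1 − cos ω))/ω² and a₂ = (v(ω − sin ω) − u(1 − cos ω))/ω², and let Q be the 3×3 real matrix with rows (1, 0, 0), (a₃, (ω/2)·sin ω/(1 − cos ω), ω/2), (a₄, −ω/2, (ω/2)·sin ω/(1 − cos ω)), where a₃ = −v/2 + (u/2)·(ω sin ω + 2 cos ω − 2)/(ω cos ω − ω) and a₄ = u/2 + (v/2)·(ω sin ω + 2 cos ω − 2)/(ω cos ω − ω). Then P · Q = I and Q · P = I, where I is the 3×3 identity matrix. -/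
open Real

/-- The closed-form expression `Q` for `dexp⁻¹` on `SE(2)` is the two-sided inverse of
the closed-form expression `P` for `dexp` on `SE(2)`. -/
theorem dexp_inv_se2 (ω u v : ℝ) (hcos : cos ω ≠ 1)
    (P Q : Matrix (Fin 3) (Fin 3) ℝ)
    (hP : P = !![1, 0, 0;
      (u * (ω - sin ω) + v * (1 - cos ω)) / ω ^ 2, sin ω / ω, -((1 - cos ω) / ω);
      (v * (ω - sin ω) - u * (1 - cos ω)) / ω ^ 2, (1 - cos ω) / ω, sin ω / ω])
    (hQ : Q = !![1, 0, 0;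
      -(v / 2) + (u / 2) * ((ω * sin ω + 2 * cos ω - 2) / (ω * cos ω - ω)),
        (ω / 2) * (sin ω / (1 - cos ω)), ω / 2;
      u / 2 + (v / 2) * ((ω * sin ω + 2 * cos ω - 2) / (ω * cos ω - ω)),
        -(ω / 2), (ω / 2) * (sin ω / (1 - cos ω))]) :
    P * Q = 1 ∧ Q * P = 1 := by
  have hω : ω ≠ 0 := fun h => hcos (by rw [h, cos_zero])
  have hd : 1 - cos ω ≠ 0 := sub_ne_zero.2 hcos.symm
  have hsq : sin ω ^ 2 = (1 - cos ω) * (1 + cos ω) := by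
    linear_combination sin_sq_add_cos_sq ω
  have hk : (ω * sin ω + 2 * cos ω - 2) / (ω * cos ω - ω) = 2 / ω - sin ω / (1 - cos ω) := by
    have hden : ω * cos ω - ω = -(ω * (1 - cos ω)) := by ring
    rw [hden]
    field_simp
    ring
  have hPQ : P * Q = 1 := by
    rw [hP, hQ, hk]
    ext i j
    fin_cases i <;> fin_cases j <;>
      simp [Matrix.mul_apply, Fin.sum_univ_three] <;> field_simp <;> grind
  exact ⟨hPQ, mul_eq_one_comm.1 hPQ⟩
end
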